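/- For every θ > 0, every integer N ≥ 1, and every a = (a_1 > a_2 > ⋯ > a_N) ∈ 𝒫_N, the iterated integral ∫_{a^{(1)} ≺ a^{(2)} ≺ ⋯ ≺ a^{(N−1)} ≺ a} ∏_{k=1}^{N−1} [ ∏_{1≤i<j≤k} |a_i^{(k)} − a_j^{(k)}|^{2−2θ} · ∏_{s=1}^{k+1} ∏_{r=1}^{k} |a_s^{(k+1)} − a_r^{(k)}|^{θ−1} ] ∏_{k=1}^{N−1} ∏_{j=1}^{k} da_j^{(k)} (where a^{(N)} := a) converges and equals ( Γ(θ)^{N(N+1)/2} / ∏_{k=1}^{N} Γ(kθ) ) · ∏_{1≤i<j≤N} |a_i − a_j|^{2θ−1}. -/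

import Mathlib

open MeasureTheory Filter Topology
open scoped ENNReal

noncomputable section

/-- A triangular array with `M` levels: for `k : Fin M`, level `k+1` has `k+1` real entries. -/
abbrev Tri (M : ℕ) := ∀ k : Fin M, Fin (k.1 + 1) → ℝ

/-- `Interlaces u v` means `u ≺ v`, i.e. `v 1 > u 1 > v 2 > u 2 > ⋯ > v n > u n > v (n+1)`. -/
def Interlaces {n : ℕ} (u : Fin n → ℝ) (v : Fin (n + 1) → ℝ) : Prop :=
  ∀ i : Fin n, u i < v i.castSucc ∧ v i.succ < u i

/-- Level `k+1` (for `k < N`) of the configuration consisting of the triangular array `x`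
(levels `1, …, N-1`) together with the top level `a` (level `N`). -/
def lvl {N : ℕ} (a : Fin N → ℝ) (x : Tri (N - 1)) (k : ℕ) (hk : k < N) :
    Fin (k + 1) → ℝ :=
  if h : k < N - 1 then fun i => x ⟨k, h⟩ i
  else fun i => a ⟨i.1, by have := i.isLt; omega⟩

/-- The (unnormalized) density of the orbital beta process with top level `a`. -/
def obpWt (θ : ℝ) {N : ℕ} (a : Fin N → ℝ) (x : Tri (N - 1)) : ℝ :=
  ∏ k : Fin (N - 1),
    ((∏ i : Fin (k.1 + 1), ∏ j : Fin (k.1 + 1),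
        if i < j then |x k i - x k j| ^ (2 - 2 * θ) else 1) *
      ∏ s : Fin (k.1 + 2), ∏ r : Fin (k.1 + 1),
        |lvl a x (k.1 + 1) (by have := k.isLt; omega) s - x k r| ^ (θ - 1))

/-- The interlacing scheme `𝒫(a)`: arrays `(a⁽¹⁾ ≺ a⁽²⁾ ≺ ⋯ ≺ a⁽ᴺ⁻¹⁾ ≺ a)`. -/
def obpDomain {N : ℕ} (a : Fin N → ℝ) : Set (Tri (N - 1)) :=
  {x | ∀ k : Fin (N - 1),
      Interlaces (x k) (lvl a x (k.1 + 1) (by have := k.isLt; omega))}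

/-- The orbital beta process `𝕄^{a,θ}` with top level `a`. -/
def obp (θ : ℝ) {N : ℕ} (a : Fin N → ℝ) : Measure (Tri (N - 1)) :=
  (ENNReal.ofReal (∫ x in obpDomain a, obpWt θ a x))⁻¹ •
    volume.withDensity fun x =>
      ENNReal.ofReal ((obpDomain a).indicator (obpWt θ a) x)

/-- The Weyl chamber `𝒲_m = {x : x 0 ≥ x 1 ≥ ⋯}`. -/
def weylChamber (m : ℕ) : Set (Fin m → ℝ) :=
  {x | ∀ i j : Fin m, i ≤ j → x j ≤ x i}

/-- The (unnormalized) density of the Gaussian beta ensemble. -/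
def gbeWt (θ : ℝ) (m : ℕ) (x : Fin m → ℝ) : ℝ :=
  (∏ i : Fin m, ∏ j : Fin m, if i < j then |x i - x j| ^ (2 * θ) else 1) *
    Real.exp (-(θ / 2) * ∑ i, x i ^ 2)

/-- The Gaussian beta ensemble `𝕄^{(θ)}_m` of rank `m`. -/
def gbe (θ : ℝ) (m : ℕ) : Measure (Fin m → ℝ) :=
  (ENNReal.ofReal (∫ x in weylChamber m, gbeWt θ m x))⁻¹ •
    volume.withDensity fun x =>
      ENNReal.ofReal ((weylChamber m).indicator (gbeWt θ m) x)

/-- The empirical measure `μ_N = (1/N) ∑ δ_{a_i/N}`. -/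
def empMeasure {N : ℕ} (a : Fin N → ℝ) : Measure ℝ :=
  ((N : ℝ≥0∞))⁻¹ • ∑ i : Fin N, Measure.dirac (a i / N)

/-- The mean `𝔼[ν]` of a measure on `ℝ`. -/
def meanM (ν : Measure ℝ) : ℝ := ∫ t, t ∂ν

/-- The variance `Var[ν]` of a measure on `ℝ`. -/
def varM (ν : Measure ℝ) : ℝ := (∫ t, t ^ 2 ∂ν) - meanM ν ^ 2

/-- A regular sequence of ordered tuples with limiting measure `μ`. -/
def RegularSeq (a : (N : ℕ) → Fin N → ℝ) (μ : Measure ℝ) : Prop :=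
  (∀ N : ℕ, 1 ≤ N → StrictAnti (a N)) ∧
  (∃ C : ℝ, ∀ N : ℕ, ∀ hN : 1 ≤ N,
      |a N ⟨0, by omega⟩| ≤ C * N ∧ |a N ⟨N - 1, by omega⟩| ≤ C * N) ∧
  IsProbabilityMeasure μ ∧
  (∃ R : ℝ, μ {t : ℝ | |t| ≤ R}ᶜ = 0) ∧
  ∀ f : BoundedContinuousFunction ℝ ℝ,
    Tendsto (fun N : ℕ => ∫ t, f t ∂empMeasure (a N)) atTop (𝓝 (∫ t, f t ∂μ))

/-- Projection of a triangular array (with top level of size `N`) to its `m`-th level. -/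
def levelProj {N : ℕ} (m : ℕ) (h1 : 1 ≤ m) (h2 : m < N) (x : Tri (N - 1)) :
    Fin m → ℝ :=
  fun i => x ⟨m - 1, by omega⟩ ⟨i.1, (by have := i.isLt; omega : i.1 < m - 1 + 1)⟩

/-- Projection of a triangular array to its bottom `m` levels. -/
def triProj {N : ℕ} (m : ℕ) (h : m < N) (x : Tri (N - 1)) : Tri m :=
  fun k i => x ⟨k.1, by have := k.isLt; omega⟩ ⟨i.1, i.isLt⟩

/-- The top level of a triangular array with `m` levels. -/
def topLvl {m : ℕ} (hm : 1 ≤ m) (x : Tri m) : Fin m → ℝ :=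
  fun i => x ⟨m - 1, by omega⟩ ⟨i.1, (by have := i.isLt; omega : i.1 < m - 1 + 1)⟩

/-- The Gelfand–Tsetlin polytope `𝒲_{m,corners}` (weak interlacing). -/
def gtPoly (m : ℕ) : Set (Tri m) :=
  {x | ∀ k : Fin m, ∀ hk : k.1 + 1 < m, ∀ i : Fin (k.1 + 1),
      x k i ≤ x ⟨k.1 + 1, hk⟩ i.castSucc ∧ x ⟨k.1 + 1, hk⟩ i.succ ≤ x k i}

/-- Unnormalized density of the Gaussian beta corners process with `m` levels. -/
def gbcWt (θ : ℝ) {m : ℕ} (hm : 1 ≤ m) (x : Tri m) : ℝ :=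
  (∏ i : Fin m, ∏ j : Fin m,
      if i < j then topLvl hm x i - topLvl hm x j else 1) *
    Real.exp (-(θ / 2) * ∑ i, topLvl hm x i ^ 2) *
    ∏ k : Fin (m - 1),
      ((∏ i : Fin (k.1 + 1), ∏ j : Fin (k.1 + 1),
          if i < j then
            |x ⟨k.1, by have := k.isLt; omega⟩ i -
              x ⟨k.1, by have := k.isLt; omega⟩ j| ^ (2 - 2 * θ)
          else 1) *
        ∏ i : Fin (k.1 + 1), ∏ j : Fin (k.1 + 2),
          |x ⟨k.1, by have := k.isLt; omega⟩ i -
            x ⟨k.1 + 1, by have := k.isLt; omega⟩ j| ^ (θ - 1))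

/-- The Gaussian beta corners process `𝕄^{(θ)}_{m,corners}`. -/
def gbc (θ : ℝ) {m : ℕ} (hm : 1 ≤ m) : Measure (Tri m) :=
  (ENNReal.ofReal (∫ x in gtPoly m, gbcWt θ hm x))⁻¹ •
    volume.withDensity fun x =>
      ENNReal.ofReal ((gtPoly m).indicator (gbcWt θ hm) x)

/-- Strict interlacing domain `x⁽¹⁾ ≺ x⁽²⁾ ≺ ⋯ ≺ x⁽ᵐ⁾` inside `Tri m`. -/
def triDomain (m : ℕ) : Set (Tri m) :=
  {x | ∀ k : Fin m, ∀ hk : k.1 + 1 < m, Interlaces (x k) (x ⟨k.1 + 1, hk⟩)}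

/-- The θ-Gibbs conditional density of the bottom `n` levels given level `n+1`. -/
def gibbsWt (θ : ℝ) (n : ℕ) (x : Tri (n + 1)) : ℝ :=
  ((∏ k : Fin (n + 1), Real.Gamma ((k.1 + 1) * θ)) /
      Real.Gamma θ ^ ((n + 1) * (n + 2) / 2)) *
    (∏ i : Fin (n + 1), ∏ j : Fin (n + 1),
      if i < j then
        (x ⟨n, Nat.lt_succ_self n⟩ i - x ⟨n, Nat.lt_succ_self n⟩ j) ^ (1 - 2 * θ)
      else 1) *
    ∏ k : Fin n,
      ((∏ i : Fin (k.1 + 1), ∏ j : Fin (k.1 + 1),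
          if i < j then
            (x ⟨k.1, by have := k.isLt; omega⟩ i -
              x ⟨k.1, by have := k.isLt; omega⟩ j) ^ (2 - 2 * θ)
          else 1) *
        ∏ i : Fin (k.1 + 1), ∏ j : Fin (k.1 + 2),
          |x ⟨k.1, by have := k.isLt; omega⟩ i -
            x ⟨k.1 + 1, by have := k.isLt; omega⟩ j| ^ (θ - 1))

/-- `|a⁽ᵏ⁾|`, the sum of the entries of level `k` (with `a⁽⁰⁾ := 0` and `a⁽ᴺ⁾ := a`). -/
def sumLvl {N : ℕ} (a : Fin N → ℝ) (x : Tri (N - 1)) (k : ℕ) : ℝ :=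
  if k = 0 then 0
  else if h : k - 1 < N - 1 then ∑ i, x ⟨k - 1, h⟩ i
  else ∑ i, a i

/-- The multivariate Bessel function `𝓑_a(y; θ)`, defined through its combinatorial
integral representation over the interlacing scheme with top level `a`. -/
def MBF (θ : ℝ) {N : ℕ} (a : Fin N → ℝ) (y : Fin N → ℂ) : ℂ :=
  ((((∏ k : Fin N, Real.Gamma ((k.1 + 1) * θ)) /
        Real.Gamma θ ^ (N * (N + 1) / 2)) : ℝ) : ℂ) *
    (((∏ i : Fin N, ∏ j : Fin N,
        if i < j then |a i - a j| ^ (1 - 2 * θ) else 1) : ℝ) : ℂ) *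
    ∫ x in obpDomain a,
      Complex.exp (∑ k : Fin N,
        y k * ((sumLvl a x (k.1 + 1) - sumLvl a x k.1 : ℝ) : ℂ)) *
      ((obpWt θ a x : ℝ) : ℂ)

/-- Padding of an `m`-tuple with `N - m` zeros: `(y_1, …, y_m, 0^{N-m})`. -/
def padC {m N : ℕ} (_h : m ≤ N) (y : Fin m → ℂ) : Fin N → ℂ :=
  fun k => if h' : k.1 < m then y ⟨k.1, h'⟩ else 0

/-- Integrand `exp(yz) ∏ (z - a_i)^{-θ}` of the left-directed contour integral,
with `w^{-θ} := exp(-θ Log w)` for the principal branch `Log`. -/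
def contourFnL (θ : ℝ) {N : ℕ} (a : Fin N → ℝ) (y z : ℂ) : ℂ :=
  Complex.exp (y * z) *
    ∏ i : Fin N, Complex.exp (-(θ : ℂ) * Complex.log (z - (a i : ℂ)))

/-- Integrand `exp(-yz) ∏ (a_i - z)^{-θ}` of the right-directed contour integral. -/
def contourFnR (θ : ℝ) {N : ℕ} (a : Fin N → ℝ) (y z : ℂ) : ℂ :=
  Complex.exp (-y * z) *
    ∏ i : Fin N, Complex.exp (-(θ : ℂ) * Complex.log ((a i : ℂ) - z))

/-- `(y_1, …, y_m, y_{m+1})` with `y_{m+1} := y - (z_1 + ⋯ + z_m)`. -/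
def Yext {m : ℕ} (ys : Fin m → ℝ) (y : ℝ) (z : Fin m → ℝ) : Fin (m + 1) → ℝ :=
  fun j => if h : j.1 < m then ys ⟨j.1, h⟩ else y - ∑ i, z i

/-- `(z_1, …, z_m, z_{m+1})` with `z_{m+1} := 0`. -/
def Zext {m : ℕ} (z : Fin m → ℝ) : Fin (m + 1) → ℝ :=
  fun j => if h : j.1 < m then z ⟨j.1, h⟩ else 0

/-- The function `G_{θ, y_1, …, y_m, y}(z_1, …, z_m)`. -/
def Gfn (θ : ℝ) {m : ℕ} (ys : Fin m → ℝ) (y : ℝ) (z : Fin m → ℝ) : ℝ :=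
  (∏ i : Fin m, ∏ j : Fin m,
      if i < j then (ys i - ys j + z i) ^ (θ - 1) else 1) *
    ∏ i : Fin (m + 1), ∏ j : Fin (m + 1),
      if i < j then
        (Yext ys y z i - Yext ys y z j + Zext z i - Zext z j) *
          (Yext ys y z i - Yext ys y z j - Zext z j) ^ (θ - 1)
      else 1

/-- The function `F_{y_1, …, y_m, y}(z_1, …, z_m)`. -/
def Ffn {m : ℕ} (ys : Fin m → ℝ) (y : ℝ) (z : Fin m → ℝ) : ℝ :=
  (1 - (∑ i, z i) / y) * ∏ i, (1 + z i / ys i)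


/-- The beta integral over `(0, t)`. -/
lemma lintegral_Ioo_rpow_mul_rpow {α β t : ℝ} (hα : 0 < α) (hβ : 0 < β) (ht : 0 < t) :
    ∫⁻ w in Set.Ioo 0 t, ENNReal.ofReal (w ^ (α - 1) * (t - w) ^ (β - 1)) =
      ENNReal.ofReal (ProbabilityTheory.beta α β * t ^ (α + β - 1)) := by
  have hB := ProbabilityTheory.beta_pos hα hβ
  have himg : (fun x : ℝ => t * x) '' Set.Ioo 0 1 = Set.Ioo 0 t := by
    rw [Set.image_mul_left_Ioo ht]; simp
  have key := lintegral_image_eq_lintegral_abs_deriv_mul (s := Set.Ioo (0 : ℝ) 1)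
    (f := fun x => t * x) (f' := fun _ => t) measurableSet_Ioo
    (fun x _ => by simpa using ((hasDerivAt_id x).const_mul t).hasDerivWithinAt)
    (fun x _ y _ h => mul_left_cancel₀ ht.ne' h)
    (fun w => ENNReal.ofReal (w ^ (α - 1) * (t - w) ^ (β - 1)))
  rw [himg] at key
  rw [key]
  have h1 := ProbabilityTheory.lintegral_betaPDF_eq_one hα hβ
  rw [ProbabilityTheory.lintegral_betaPDF] at h1
  calc _ = ∫⁻ x in Set.Ioo (0 : ℝ) 1,
        ENNReal.ofReal (ProbabilityTheory.beta α β * t ^ (α + β - 1)) *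
        ENNReal.ofReal (1 / ProbabilityTheory.beta α β * x ^ (α - 1) * (1 - x) ^ (β - 1)) := by
        refine setLIntegral_congr_fun measurableSet_Ioo fun x hx => ?_
        have hx1 : 0 < 1 - x := sub_pos.2 hx.2
        rw [← ENNReal.ofReal_mul (abs_nonneg _), ← ENNReal.ofReal_mul (by positivity)]
        congr 1
        rw [abs_of_pos ht, show t - t * x = t * (1 - x) by ring,
          Real.mul_rpow ht.le hx.1.le, Real.mul_rpow ht.le hx1.le,
          show α + β - 1 = 1 + (α - 1) + (β - 1) by ring, Real.rpow_add ht, Real.rpow_add ht,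
          Real.rpow_one]
        field_simp
    _ = _ := by
        rw [lintegral_const_mul' _ _ ENNReal.ofReal_ne_top, h1, mul_one]

/-- The open corner simplex of size `t`. -/
def cornerSimplex (n : ℕ) (t : ℝ) : Set (Fin n → ℝ) :=
  {w | (∀ i, 0 < w i) ∧ ∑ i, w i < t}

lemma measurableSet_cornerSimplex (n : ℕ) (t : ℝ) : MeasurableSet (cornerSimplex n t) := by
  have h : cornerSimplex n t = (⋂ i, {w | 0 < w i}) ∩ {w | ∑ i, w i < t} := by
    ext; simp [cornerSimplex]
  rw [h]
  exact (MeasurableSet.iInter fun i => measurableSet_lt measurable_const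
    (measurable_pi_apply i)).inter (measurableSet_lt (Finset.measurable_fun_sum _ fun i _ =>
      measurable_pi_apply i) measurable_const)

lemma lintegral_cornerSimplex {θ β : ℝ} (hθ : 0 < θ) (hβ : 0 < β) (n : ℕ) :
    ∀ t : ℝ, 0 < t →
    ∫⁻ w in cornerSimplex n t,
        ENNReal.ofReal ((∏ i, w i ^ (θ - 1)) * (t - ∑ i, w i) ^ (β - 1)) =
      ENNReal.ofReal (Real.Gamma θ ^ n * Real.Gamma β / Real.Gamma (n * θ + β) *
        t ^ (n * θ + β - 1)) := by
  induction n with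
  | zero =>
    intro t ht
    have : cornerSimplex 0 t = Set.univ := by ext; simp [cornerSimplex, ht]
    rw [this, Measure.restrict_univ, Measure.volume_pi_eq_dirac]
    simp [(Real.Gamma_pos_of_pos hβ).ne']
  | succ n ih =>
    intro t ht
    have hnb : 0 < n * θ + β := by positivity
    set C := Real.Gamma θ ^ n * Real.Gamma β / Real.Gamma (n * θ + β) with hC
    have hCnn : 0 ≤ C := by
      have := Real.Gamma_pos_of_pos hθ
      have := Real.Gamma_pos_of_pos hβ
      have := Real.Gamma_pos_of_pos hnb
      positivity
    have e := (volume_preserving_piFinSuccAbove (fun _ : Fin (n + 1) => ℝ) 0).symm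
    rw [← lintegral_indicator (measurableSet_cornerSimplex _ _),
      ← e.lintegral_comp_emb (MeasurableEquiv.measurableEmbedding _), Measure.volume_eq_prod,
      lintegral_prod _ (by
        refine Measurable.aemeasurable (Measurable.comp (Measurable.indicator ?_
          (measurableSet_cornerSimplex _ _)) (MeasurableEquiv.measurable _))
        fun_prop)]
    calc _ = ∫⁻ w : ℝ, (Set.Ioo 0 t).indicator (fun w => ENNReal.ofReal C *
          ENNReal.ofReal (w ^ (θ - 1) * (t - w) ^ ((n * θ + β) - 1))) w := by
          refine lintegral_congr fun w => ?_
          by_cases hw : w ∈ Set.Ioo 0 t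
          · rw [Set.indicator_of_mem hw]
            have h0 := Real.rpow_nonneg hw.1.le (θ - 1)
            rw [← ENNReal.ofReal_mul hCnn, mul_left_comm, ENNReal.ofReal_mul h0,
              ← ih (t - w) (sub_pos.2 hw.2), ← lintegral_const_mul' _ _ ENNReal.ofReal_ne_top,
              ← lintegral_indicator (measurableSet_cornerSimplex _ _)]
            refine lintegral_congr fun v => ?_
            have hmem : (MeasurableEquiv.piFinSuccAbove (fun _ : Fin (n + 1) => ℝ) 0).symm (w, v) ∈
                cornerSimplex (n + 1) t ↔ v ∈ cornerSimplex n (t - w) := by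
              simp [cornerSimplex, Fin.forall_fin_succ, Fin.sum_univ_succ, hw.1,
                MeasurableEquiv.piFinSuccAbove, lt_sub_iff_add_lt']
            by_cases hv : v ∈ cornerSimplex n (t - w)
            · rw [Set.indicator_of_mem hv, Set.indicator_of_mem (hmem.2 hv),
                ← ENNReal.ofReal_mul h0]
              congr 1
              simp [Fin.prod_univ_succ, Fin.sum_univ_succ, MeasurableEquiv.piFinSuccAbove,
                mul_assoc, sub_sub]
            · rw [Set.indicator_of_notMem hv, Set.indicator_of_notMem (fun h => hv (hmem.1 h))]
          · rw [Set.indicator_of_notMem hw, lintegral_eq_zero_of_ae_eq_zero]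
            refine Eventually.of_forall fun v => Set.indicator_of_notMem (fun h => hw ?_) _
            have h1 := h.1 0
            have h2 := h.2
            have h3 := Finset.sum_nonneg fun i (_ : i ∈ Finset.univ) => (h.1 (Fin.succ i)).le
            rw [Fin.sum_univ_succ] at h2
            simp [MeasurableEquiv.piFinSuccAbove] at h1 h2 h3
            exact ⟨h1, by linarith⟩
      _ = _ := by
          rw [lintegral_indicator measurableSet_Ioo, lintegral_const_mul' _ _ ENNReal.ofReal_ne_top,
            lintegral_Ioo_rpow_mul_rpow hθ hnb ht, ← ENNReal.ofReal_mul hCnn]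
          congr 1
          have := (Real.Gamma_pos_of_pos hnb).ne'
          rw [ProbabilityTheory.beta, hC, ← mul_assoc,
            show θ + (n * θ + β) = ((n + 1 : ℕ) : ℝ) * θ + β by push_cast; ring]
          congr 1
          field_simp
          ring

/-- The absolute value of the Vandermonde product of `v`. -/
def absVandermonde {n : ℕ} (v : Fin n → ℝ) : ℝ :=
  ∏ i, ∏ j, if i < j then |v i - v j| else 1

lemma absVandermonde_nonneg {n : ℕ} (v : Fin n → ℝ) : 0 ≤ absVandermonde v :=
  Finset.prod_nonneg fun i _ => Finset.prod_nonneg fun j _ => by split_ifs <;> positivity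

lemma absVandermonde_pos {n : ℕ} {v : Fin n → ℝ} (hv : Function.Injective v) :
    0 < absVandermonde v := by
  refine Finset.prod_pos fun i _ => Finset.prod_pos fun j _ => ?_
  split_ifs with h
  · exact abs_pos.2 (sub_ne_zero.2 (hv.ne h.ne))
  · exact one_pos

lemma prod_rpow_eq_absVandermonde_rpow {n : ℕ} (v : Fin n → ℝ) (p : ℝ) :
    (∏ i, ∏ j, if i < j then |v i - v j| ^ p else 1) = absVandermonde v ^ p := by
  have h (i j : Fin n) : 0 ≤ if i < j then |v i - v j| else 1 := by split_ifs <;> positivity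
  rw [absVandermonde, ← Real.finsetProd_rpow _ _ fun i _ => Finset.prod_nonneg fun j _ => h i j]
  refine Finset.prod_congr rfl fun i _ => ?_
  rw [← Real.finsetProd_rpow _ _ fun j _ => h i j]
  refine Finset.prod_congr rfl fun j _ => ?_
  split_ifs <;> simp

lemma abs_det_vandermonde {n : ℕ} (v : Fin n → ℝ) :
    |(Matrix.vandermonde v).det| = absVandermonde v := by
  rw [Matrix.det_vandermonde, Finset.abs_prod, absVandermonde]
  refine Finset.prod_congr rfl fun i _ => ?_
  rw [Finset.abs_prod, ← Finset.prod_filter]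
  refine Finset.prod_congr (by ext; simp) fun j _ => abs_sub_comm _ _

lemma prod_prod_erase_abs_sub {n : ℕ} (v : Fin n → ℝ) :
    ∏ i, ∏ j ∈ Finset.univ.erase i, |v i - v j| = absVandermonde v ^ 2 := by
  have h (i : Fin n) : ∏ j ∈ Finset.univ.erase i, |v i - v j| =
      (∏ j, if i < j then |v i - v j| else 1) * ∏ j, if j < i then |v j - v i| else 1 := by
    rw [← Finset.prod_mul_distrib, ← Finset.mul_prod_erase _ _ (Finset.mem_univ i)]
    simp only [lt_self_iff_false, if_false, one_mul]
    refine Finset.prod_congr rfl fun j hj => ?_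
    rcases lt_or_gt_of_ne (Finset.ne_of_mem_erase hj) with h | h
    · simp [h, h.not_gt, abs_sub_comm]
    · simp [h, h.not_gt]
  simp_rw [h]
  rw [Finset.prod_mul_distrib, sq]
  congr 1
  exact Finset.prod_comm

/-- The product of the differences between `b s` and all the other entries of `b`. -/
def nodeProd {n : ℕ} (b : Fin (n + 1) → ℝ) (s : Fin (n + 1)) : ℝ :=
  ∏ r, (b s - b (s.succAbove r))

lemma nodeProd_eq_prod_erase {n : ℕ} (b : Fin (n + 1) → ℝ) (s : Fin (n + 1)) :
    nodeProd b s = ∏ t ∈ Finset.univ.erase s, (b s - b t) := by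
  have : Finset.univ.erase s = Finset.univ.image s.succAbove := by
    ext t; simp
  rw [this, Finset.prod_image (Fin.succAbove_right_injective.injOn), nodeProd]

lemma nodeProd_ne_zero {n : ℕ} {b : Fin (n + 1) → ℝ} (hb : Function.Injective b)
    (s : Fin (n + 1)) : nodeProd b s ≠ 0 :=
  Finset.prod_ne_zero_iff.2 fun _ _ => sub_ne_zero.2 (hb.ne (Fin.succAbove_ne _ _).symm)

lemma prod_abs_nodeProd {n : ℕ} (b : Fin (n + 1) → ℝ) :
    ∏ s, |nodeProd b s| = absVandermonde b ^ 2 := by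
  simp_rw [nodeProd_eq_prod_erase, Finset.abs_prod]
  exact prod_prod_erase_abs_sub b

lemma absVandermonde_castSucc {n : ℕ} (b : Fin (n + 1) → ℝ) :
    absVandermonde b = absVandermonde (fun s : Fin n => b s.castSucc) *
      |nodeProd b (Fin.last n)| := by
  simp [absVandermonde, nodeProd, Fin.prod_univ_castSucc, Finset.prod_mul_distrib,
    Finset.abs_prod, abs_sub_comm, Fin.castSucc_lt_last, (Fin.castSucc_lt_last _).not_gt]

lemma prod_abs_nodeProd_castSucc {n : ℕ} {b : Fin (n + 1) → ℝ} (hb : Function.Injective b) :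
    ∏ s : Fin n, |nodeProd b s.castSucc| =
      absVandermonde b * absVandermonde (fun s : Fin n => b s.castSucc) := by
  have h := prod_abs_nodeProd b
  rw [Fin.prod_univ_castSucc, sq] at h
  nth_rw 2 [absVandermonde_castSucc b] at h
  rw [← mul_assoc] at h
  exact mul_right_cancel₀ (abs_ne_zero.2 (nodeProd_ne_zero hb _)) h

lemma neg_one_pow_mul_nodeProd_pos {n : ℕ} {b : Fin (n + 1) → ℝ} (hb : StrictAnti b)
    (s : Fin (n + 1)) : 0 < (-1) ^ (s : ℕ) * nodeProd b s := by
  have hcard : (-1 : ℝ) ^ (s : ℕ) = ∏ r : Fin n, if r.castSucc < s then -1 else 1 := by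
    rw [Finset.prod_ite]
    have h : (Finset.univ.filter fun r : Fin n => r.castSucc < s).card = s := by
      have := Fin.card_filter_val_lt (n := n) (m := s)
      simpa [Fin.lt_def, Nat.lt_succ_iff.1 s.isLt] using this
    simp [h]
  rw [hcard, nodeProd, ← Finset.prod_mul_distrib]
  refine Finset.prod_pos fun r _ => ?_
  split_ifs with h
  · have := hb h
    rw [Fin.succAbove_of_castSucc_lt _ _ h]
    linarith
  · have := hb (Fin.le_castSucc_iff.1 (not_lt.1 h))
    rw [Fin.succAbove_of_le_castSucc _ _ (not_lt.1 h)]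
    linarith

/-- The residue at `b s` of the rational function `∏ (z - a r) / ∏ (z - b t)`. -/
def interlacingResidue {n : ℕ} (b : Fin (n + 1) → ℝ) (a : Fin n → ℝ) (s : Fin (n + 1)) : ℝ :=
  (∏ r, (b s - a r)) / nodeProd b s

lemma Interlaces.strictAnti {n : ℕ} {a : Fin n → ℝ} {b : Fin (n + 1) → ℝ}
    (h : Interlaces a b) : StrictAnti a := by
  cases n with
  | zero => exact fun i => i.elim0
  | succ n =>
    refine Fin.strictAnti_iff_succ_lt.2 fun i => ?_
    have h1 := (h i.succ).1
    have h2 := (h i.castSucc).2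
    rw [Fin.succ_castSucc] at h2
    exact h1.trans h2

lemma Interlaces.lt_of_le {n : ℕ} {a : Fin n → ℝ} {b : Fin (n + 1) → ℝ} (hb : StrictAnti b)
    (h : Interlaces a b) {s : Fin (n + 1)} {r : Fin n} (hs : s ≤ r.castSucc) : a r < b s :=
  (h r).1.trans_le (hb.antitone hs)

lemma Interlaces.lt_of_lt {n : ℕ} {a : Fin n → ℝ} {b : Fin (n + 1) → ℝ} (hb : StrictAnti b)
    (h : Interlaces a b) {s : Fin (n + 1)} {r : Fin n} (hs : r.castSucc < s) : b s < a r :=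
  (hb.antitone (Fin.castSucc_lt_iff_succ_le.1 hs)).trans_lt (h r).2

lemma interlacingResidue_pos {n : ℕ} {a : Fin n → ℝ} {b : Fin (n + 1) → ℝ} (hb : StrictAnti b)
    (h : Interlaces a b) (s : Fin (n + 1)) : 0 < interlacingResidue b a s := by
  rw [interlacingResidue, nodeProd, ← Finset.prod_div_distrib]
  refine Finset.prod_pos fun r _ => ?_
  rcases lt_or_ge r.castSucc s with hs | hs
  · rw [Fin.succAbove_of_castSucc_lt _ _ hs]
    exact div_pos_of_neg_of_neg (sub_neg.2 (h.lt_of_lt hb hs)) (sub_neg.2 (hb hs))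
  · rw [Fin.succAbove_of_le_castSucc _ _ hs]
    exact div_pos (sub_pos.2 (h.lt_of_le hb hs)) (sub_pos.2 (hb (Fin.le_castSucc_iff.1 hs)))

open Polynomial in
lemma natDegree_prod_X_sub_C_fin {n : ℕ} (a : Fin n → ℝ) :
    (∏ r, (X - C (a r))).natDegree = n := by
  simp

open Polynomial in
lemma degree_prod_X_sub_C_lt {n : ℕ} (a : Fin n → ℝ) :
    (∏ r, (X - C (a r))).degree < ((n + 1 : ℕ) : WithBot ℕ) := by
  rw [degree_eq_natDegree (monic_prod_X_sub_C a Finset.univ).ne_zero, natDegree_prod_X_sub_C_fin]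
  exact_mod_cast Nat.lt_succ_self n

open Polynomial in
lemma coeff_prod_X_sub_C_fin {n : ℕ} (a : Fin n → ℝ) :
    (∏ r, (X - C (a r))).coeff n = 1 := by
  have h := (monic_prod_X_sub_C a Finset.univ).coeff_natDegree
  rwa [natDegree_prod_X_sub_C_fin] at h

open Polynomial in
lemma sum_interlacingResidue {n : ℕ} (a : Fin n → ℝ) {b : Fin (n + 1) → ℝ}
    (hb : Function.Injective b) : ∑ s, interlacingResidue b a s = 1 := by
  have h := Lagrange.coeff_eq_sum (s := Finset.univ) hb.injOn
    (by simpa using degree_prod_X_sub_C_lt a)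
  simp only [Finset.card_univ, Fintype.card_fin, Nat.add_sub_cancel, coeff_prod_X_sub_C_fin,
    eval_prod, eval_sub, eval_X, eval_C] at h
  simp only [interlacingResidue, nodeProd_eq_prod_erase, ← h]

open Polynomial in
/-- A polynomial of degree at most `n` with top coefficient `1` is determined by its values at
`n` points. -/
lemma eq_of_eval_eq_of_coeff_eq_one {n : ℕ} {P Q : ℝ[X]} (hP : P.degree < ((n + 1 : ℕ) : WithBot ℕ))
    (hQ : Q.degree < ((n + 1 : ℕ) : WithBot ℕ)) (hP1 : P.coeff n = 1) (hQ1 : Q.coeff n = 1)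
    {c : Fin n → ℝ} (hc : Function.Injective c) (h : ∀ s, P.eval (c s) = Q.eval (c s)) :
    P = Q := by
  refine eq_of_degree_sub_lt_of_eval_index_eq Finset.univ hc.injOn ?_ fun i _ => h i
  rw [Finset.card_univ, Fintype.card_fin, degree_lt_iff_coeff_zero]
  intro m hm
  rcases hm.eq_or_lt with rfl | hm
  · simp [hP1, hQ1]
  · rw [degree_lt_iff_coeff_zero] at hP hQ
    simp [hP m hm, hQ m hm]

/-- The first `n` residues, as functions of the interlacing points. -/
def residueMap {n : ℕ} (b : Fin (n + 1) → ℝ) (a : Fin n → ℝ) (s : Fin n) : ℝ :=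
  interlacingResidue b a s.castSucc

lemma interlacingResidue_last {n : ℕ} (a : Fin n → ℝ) {b : Fin (n + 1) → ℝ}
    (hb : Function.Injective b) :
    interlacingResidue b a (Fin.last n) = 1 - ∑ s, residueMap b a s := by
  have h := sum_interlacingResidue a hb
  rw [Fin.sum_univ_castSucc] at h
  simp only [residueMap]
  linarith

open Polynomial in
lemma injOn_residueMap {n : ℕ} {b : Fin (n + 1) → ℝ} (hb : StrictAnti b) :
    Set.InjOn (residueMap b) {a | Interlaces a b} := by
  intro a ha a' ha' h
  have hP : ∏ r, (X - C (a r)) = ∏ r, (X - C (a' r)) := by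
    refine eq_of_eval_eq_of_coeff_eq_one (degree_prod_X_sub_C_lt a) (degree_prod_X_sub_C_lt a')
      (coeff_prod_X_sub_C_fin a) (coeff_prod_X_sub_C_fin a')
      (c := fun s : Fin n => b s.castSucc)
      (hb.injective.comp (Fin.castSucc_injective n)) fun s => ?_
    have := congrFun h s
    simp only [residueMap, interlacingResidue] at this
    rw [div_left_inj' (nodeProd_ne_zero hb.injective _)] at this
    simpa [eval_prod] using this
  funext r
  have h0 : (∏ q, (X - C (a' q))).eval (a r) = 0 := by
    rw [← hP, eval_prod]
    exact Finset.prod_eq_zero (Finset.mem_univ r) (by simp)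
  rw [eval_prod, Finset.prod_eq_zero_iff] at h0
  obtain ⟨q, -, hq⟩ := h0
  have hq : a r = a' q := by simpa [sub_eq_zero] using hq
  rcases lt_trichotomy r q with hlt | rfl | hlt
  · have h1 := ha'.lt_of_le hb (s := r.succ) (r := q) (Fin.succ_le_castSucc_iff.2 hlt)
    have h2 := (ha r).2
    linarith
  · exact hq
  · have h1 := ha.lt_of_le hb (s := q.succ) (r := r) (Fin.succ_le_castSucc_iff.2 hlt)
    have h2 := (ha' q).2
    linarith

open Polynomial in
lemma image_residueMap {n : ℕ} {b : Fin (n + 1) → ℝ} (hb : StrictAnti b) :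
    residueMap b '' {a | Interlaces a b} = cornerSimplex n 1 := by
  refine Set.Subset.antisymm ?_ fun w hw => ?_
  · rintro _ ⟨a, ha, rfl⟩
    refine ⟨fun i => interlacingResidue_pos hb ha _, ?_⟩
    have := interlacingResidue_pos hb ha (Fin.last n)
    rw [interlacingResidue_last a hb.injective] at this
    linarith
  set W : Fin (n + 1) → ℝ := Fin.snoc w (1 - ∑ i, w i) with hW
  have hWpos : ∀ s, 0 < W s := by
    refine Fin.lastCases ?_ fun i => ?_
    · simpa [hW] using hw.2
    · simpa [hW] using hw.1 i
  have hWsum : ∑ s, W s = 1 := by simp [hW, Fin.sum_univ_castSucc]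
  set P := Lagrange.interpolate Finset.univ b fun s => W s * nodeProd b s with hP
  have hdeg : P.degree < ((n + 1 : ℕ) : WithBot ℕ) := by
    have := Lagrange.degree_interpolate_lt (s := Finset.univ) (v := b)
      (fun s => W s * nodeProd b s) hb.injective.injOn
    rwa [Finset.card_univ, Fintype.card_fin] at this
  have heval (s : Fin (n + 1)) : P.eval (b s) = W s * nodeProd b s :=
    Lagrange.eval_interpolate_at_node _ hb.injective.injOn (Finset.mem_univ s)
  have hcoeff : P.coeff n = 1 := by
    have h := Lagrange.coeff_eq_sum (s := Finset.univ) hb.injective.injOn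
      (by simpa using hdeg)
    simp only [Finset.card_univ, Fintype.card_fin, Nat.add_sub_cancel, heval,
      ← nodeProd_eq_prod_erase, mul_div_cancel_right₀ _ (nodeProd_ne_zero hb.injective _),
      hWsum] at h
    exact h
  have hroot (r : Fin n) : ∃ x ∈ Set.Ioo (b r.succ) (b r.castSucc), P.eval x = 0 := by
    have hlt : b r.succ < b r.castSucc := hb r.castSucc_lt_succ
    have hcont : ContinuousOn (fun x => (-1) ^ (r : ℕ) * P.eval x)
      (Set.Icc (b r.succ) (b r.castSucc)) := by fun_prop
    have h1 : 0 < (-1) ^ (r : ℕ) * P.eval (b r.castSucc) := by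
      have := mul_pos (hWpos r.castSucc) (neg_one_pow_mul_nodeProd_pos hb r.castSucc)
      rw [heval]
      simp only [Fin.val_castSucc] at this
      linarith
    have h2 : (-1) ^ (r : ℕ) * P.eval (b r.succ) < 0 := by
      have := mul_pos (hWpos r.succ) (neg_one_pow_mul_nodeProd_pos hb r.succ)
      rw [heval]
      simp only [Fin.val_succ, pow_succ] at this
      linarith
    obtain ⟨x, hx, hx0⟩ := intermediate_value_Ioo hlt.le hcont ⟨h2, h1⟩
    exact ⟨x, hx, by simpa using hx0⟩
  choose a ha ha0 using hroot
  have hint : Interlaces a b := fun r => ⟨(ha r).2, (ha r).1⟩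
  have hPa : ∏ r, (X - C (a r)) = P := by
    refine eq_of_eval_eq_of_coeff_eq_one (degree_prod_X_sub_C_lt a) hdeg
      (coeff_prod_X_sub_C_fin a) hcoeff hint.strictAnti.injective fun r => ?_
    rw [ha0, eval_prod]
    exact Finset.prod_eq_zero (Finset.mem_univ r) (by simp)
  refine ⟨a, hint, funext fun s => ?_⟩
  have h := heval s.castSucc
  rw [← hPa, eval_prod] at h
  simp only [eval_sub, eval_X, eval_C] at h
  rw [residueMap, interlacingResidue, h,
    mul_div_cancel_right₀ _ (nodeProd_ne_zero hb.injective _), hW, Fin.snoc_castSucc]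

/-- The Jacobian matrix of `residueMap b` at `a`. -/
def residueJacobian {n : ℕ} (b : Fin (n + 1) → ℝ) (a : Fin n → ℝ) : Matrix (Fin n) (Fin n) ℝ :=
  Matrix.of fun s r =>
    -(nodeProd b s.castSucc)⁻¹ * ∏ q ∈ Finset.univ.erase r, (b s.castSucc - a q)

lemma hasFDerivAt_residueMap {n : ℕ} (b : Fin (n + 1) → ℝ) (a : Fin n → ℝ) :
    HasFDerivAt (residueMap b) (Matrix.toLin' (residueJacobian b a)).toContinuousLinearMap a := by
  rw [hasFDerivAt_pi']
  intro s
  have h := (HasFDerivAt.finsetProd (u := Finset.univ) (x := a)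
    (g := fun (r : Fin n) (x : Fin n → ℝ) => b s.castSucc - x r)
    fun r _ => (hasFDerivAt_apply (𝕜 := ℝ) r a).const_sub (b s.castSucc)).mul_const
      (nodeProd b s.castSucc)⁻¹
  refine h.congr_fderiv ?_
  ext v
  simp [residueJacobian, Matrix.toLin'_apply, Matrix.mulVec, dotProduct, Finset.mul_sum]
  refine Finset.sum_congr rfl fun r _ => ?_
  ring

open Polynomial in
lemma abs_det_prod_erase_sub {n : ℕ} (c : Fin n → ℝ) {a : Fin n → ℝ}
    (ha : Function.Injective a) :
    |(Matrix.of fun s r => ∏ q ∈ Finset.univ.erase r, (c s - a q)).det| =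
      absVandermonde c * absVandermonde a := by
  set M : Matrix (Fin n) (Fin n) ℝ := Matrix.of fun s r => ∏ q ∈ Finset.univ.erase r, (c s - a q)
  set d : Fin n → ℝ := fun r => ∏ q ∈ Finset.univ.erase r, (a r - a q)
  have hfac : M * (Matrix.diagonal d⁻¹ * Matrix.vandermonde a) = Matrix.vandermonde c := by
    ext s k
    have hk : ((X : ℝ[X]) ^ (k : ℕ)).degree < ((Finset.univ : Finset (Fin n)).card : WithBot ℕ) := by
      simp
    have h := congrArg (eval (c s)) (Lagrange.eq_interpolate ha.injOn hk)
    rw [Lagrange.interpolate_eq_sum] at h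
    simp only [eval_pow, eval_X, eval_finsetSum, eval_mul, eval_C, eval_prod, eval_sub] at h
    rw [Matrix.vandermonde_apply, h, Matrix.mul_apply]
    refine Finset.sum_congr rfl fun r _ => ?_
    simp only [Matrix.diagonal_mul, Matrix.vandermonde_apply, M, d, Matrix.of_apply, Pi.inv_apply]
    ring
  have hdet := congrArg (fun A => |Matrix.det A|) hfac
  have hd : |∏ r, d⁻¹ r| = (absVandermonde a ^ 2)⁻¹ := by
    rw [← prod_prod_erase_abs_sub, ← Finset.prod_inv_distrib, Finset.abs_prod]
    exact Finset.prod_congr rfl fun r _ => by simp [d, Finset.abs_prod, abs_inv]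
  simp only [Matrix.det_mul, Matrix.det_diagonal, abs_mul, abs_det_vandermonde, hd] at hdet
  have := (absVandermonde_pos ha).ne'
  rw [← hdet]
  field_simp

lemma abs_det_residueJacobian {n : ℕ} {b : Fin (n + 1) → ℝ} (hb : Function.Injective b)
    {a : Fin n → ℝ} (ha : Function.Injective a) :
    |(residueJacobian b a).det| = absVandermonde a / absVandermonde b := by
  have h := Matrix.det_mul_column (fun s : Fin n => -(nodeProd b s.castSucc)⁻¹)
    (Matrix.of fun s r => ∏ q ∈ Finset.univ.erase r, (b s.castSucc - a q))
  simp only [Matrix.of_apply] at h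
  rw [residueJacobian, h, abs_mul, abs_det_prod_erase_sub _ ha,
    Finset.abs_prod]
  simp only [abs_neg, abs_inv]
  have hc := (absVandermonde_pos (hb.comp (Fin.castSucc_injective n))).ne'
  have hb' := (absVandermonde_pos hb).ne'
  rw [Finset.prod_inv_distrib, prod_abs_nodeProd_castSucc hb]
  simp only [Function.comp_def] at hc
  field_simp

lemma measurableSet_interlaces {n : ℕ} (b : Fin (n + 1) → ℝ) :
    MeasurableSet {a : Fin n → ℝ | Interlaces a b} := by
  have h : {a : Fin n → ℝ | Interlaces a b} =
      ⋂ i, ({a | a i < b i.castSucc} ∩ {a | b i.succ < a i}) := by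
    ext; simp [Interlaces]
  rw [h]
  exact MeasurableSet.iInter fun i => (measurableSet_lt (measurable_pi_apply i)
    measurable_const).inter (measurableSet_lt measurable_const (measurable_pi_apply i))

/-- The Dixon–Anderson integral with equal exponents. -/
theorem lintegral_interlaces {θ : ℝ} (hθ : 0 < θ) {n : ℕ} {b : Fin (n + 1) → ℝ}
    (hb : StrictAnti b) :
    ∫⁻ a in {a | Interlaces a b},
        ENNReal.ofReal (absVandermonde a * ∏ s, ∏ r, |b s - a r| ^ (θ - 1)) =
      ENNReal.ofReal (Real.Gamma θ ^ (n + 1) / Real.Gamma ((n + 1) * θ) *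
        absVandermonde b ^ (2 * θ - 1)) := by
  have hbpos := absVandermonde_pos hb.injective
  have hcv := lintegral_image_eq_lintegral_abs_det_fderiv_mul volume (measurableSet_interlaces b)
    (fun a _ => (hasFDerivAt_residueMap b a).hasFDerivWithinAt) (injOn_residueMap hb)
    (fun w => ENNReal.ofReal ((∏ i, w i ^ (θ - 1)) * (1 - ∑ i, w i) ^ (θ - 1)))
  rw [image_residueMap hb, lintegral_cornerSimplex hθ hθ n 1 one_pos] at hcv
  have hΓ : Real.Gamma θ ^ n * Real.Gamma θ / Real.Gamma (n * θ + θ) * 1 ^ (n * θ + θ - 1) =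
      Real.Gamma θ ^ (n + 1) / Real.Gamma ((n + 1) * θ) := by
    rw [Real.one_rpow, mul_one, pow_succ, add_one_mul]
  rw [hΓ] at hcv
  rw [mul_comm (_ / _), ENNReal.ofReal_mul (by positivity), hcv,
    ← lintegral_const_mul' _ _ ENNReal.ofReal_ne_top]
  refine setLIntegral_congr_fun (measurableSet_interlaces b) fun a ha => ?_
  have hW := interlacingResidue_pos hb ha
  have hprod : ∏ s, ∏ r, |b s - a r| ^ (θ - 1) =
      (∏ s, interlacingResidue b a s ^ (θ - 1)) * (absVandermonde b ^ 2) ^ (θ - 1) := by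
    rw [← prod_abs_nodeProd, ← Real.finsetProd_rpow _ _ fun s _ => abs_nonneg _,
      ← Finset.prod_mul_distrib]
    refine Finset.prod_congr rfl fun s _ => ?_
    rw [← Real.mul_rpow (hW s).le (abs_nonneg _), Real.finsetProd_rpow _ _ fun r _ => abs_nonneg _,
      ← Finset.abs_prod, ← abs_of_pos (hW s), ← abs_mul, interlacingResidue,
      div_mul_cancel₀ _ (nodeProd_ne_zero hb.injective s)]
  rw [LinearMap.det_toContinuousLinearMap, LinearMap.det_toLin',
    abs_det_residueJacobian hb.injective ha.strictAnti.injective, hprod,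
    ← ENNReal.ofReal_mul (div_nonneg (absVandermonde_nonneg a) hbpos.le),
    ← ENNReal.ofReal_mul (by positivity), ← interlacingResidue_last a hb.injective,
    Fin.prod_univ_castSucc]
  congr 1
  simp only [residueMap]
  have hpow : absVandermonde b ^ (2 * θ - 1) =
      (absVandermonde b ^ 2) ^ (θ - 1) * absVandermonde b := by
    rw [← Real.rpow_natCast, ← Real.rpow_mul hbpos.le]
    nth_rw 3 [← Real.rpow_one (absVandermonde b)]
    rw [← Real.rpow_add hbpos]
    congr 1
    push_cast
    ring
  rw [hpow]
  field_simp

/-- Appending a last coordinate preserves product volumes. -/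
lemma measurePreserving_snoc {n : ℕ} (α : Fin (n + 1) → Type) [∀ i, MeasureSpace (α i)]
    [∀ i, SigmaFinite (volume : Measure (α i))] :
    MeasurePreserving
      (fun p : α (Fin.last n) × (∀ i : Fin n, α i.castSucc) => (Fin.snoc p.2 p.1 : ∀ i, α i)) := by
  have hm : Measurable
      (fun p : α (Fin.last n) × (∀ i : Fin n, α i.castSucc) => (Fin.snoc p.2 p.1 : ∀ i, α i)) := by
    refine measurable_pi_iff.2 (Fin.lastCases ?_ fun i => ?_)
    · simpa using measurable_fst
    · simpa [Function.comp_def] using (measurable_pi_apply i).comp measurable_snd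
  refine ⟨hm, (Measure.pi_eq fun s hs => ?_).symm⟩
  have hpre : (fun p : α (Fin.last n) × (∀ i : Fin n, α i.castSucc) =>
      (Fin.snoc p.2 p.1 : ∀ i, α i)) ⁻¹' Set.univ.pi s =
      s (Fin.last n) ×ˢ Set.univ.pi fun i : Fin n => s i.castSucc := by
    ext p
    simp [Set.mem_pi, Fin.forall_fin_succ', and_comm]
  rw [Measure.map_apply hm (MeasurableSet.univ_pi hs), hpre, Measure.volume_eq_prod,
    Measure.prod_prod, volume_pi, Measure.pi_pi, Fin.prod_univ_castSucc, mul_comm]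

lemma measurable_lvl {N : ℕ} (a : Fin N → ℝ) (k : ℕ) (hk : k < N) (i : Fin (k + 1)) :
    Measurable fun x : Tri (N - 1) => lvl a x k hk i := by
  unfold lvl
  split_ifs with h
  · exact (measurable_pi_apply i).comp (measurable_pi_apply (⟨k, h⟩ : Fin (N - 1)))
  · exact measurable_const

lemma measurable_tri_apply {M : ℕ} (k : Fin M) (i : Fin (k.1 + 1)) :
    Measurable fun x : Tri M => x k i :=
  (measurable_pi_apply i).comp (measurable_pi_apply k)

lemma measurable_obpWt (θ : ℝ) {N : ℕ} (a : Fin N → ℝ) : Measurable (obpWt θ a) := by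
  unfold obpWt
  refine Finset.measurable_fun_prod _ fun k _ => Measurable.mul
    (Finset.measurable_fun_prod _ fun i _ => Finset.measurable_fun_prod _ fun j _ => ?_)
    (Finset.measurable_fun_prod _ fun s _ => Finset.measurable_fun_prod _ fun r _ => ?_)
  · split_ifs
    · exact ((measurable_tri_apply k i).sub (measurable_tri_apply k j)).abs.pow_const _
    · exact measurable_const
  · exact ((measurable_lvl a _ _ s).sub (measurable_tri_apply k r)).abs.pow_const _

lemma measurableSet_obpDomain {N : ℕ} (a : Fin N → ℝ) : MeasurableSet (obpDomain a) := by
  have h : obpDomain a = ⋂ (k : Fin (N - 1)) (i : Fin (k.1 + 1)),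
      ({x | x k i < lvl a x (k.1 + 1) (by have := k.isLt; omega) i.castSucc} ∩
        {x | lvl a x (k.1 + 1) (by have := k.isLt; omega) i.succ < x k i}) := by
    ext; simp [obpDomain, Interlaces]
  rw [h]
  exact MeasurableSet.iInter fun k => MeasurableSet.iInter fun i =>
    (measurableSet_lt (measurable_tri_apply k i) (measurable_lvl a _ _ _)).inter
      (measurableSet_lt (measurable_lvl a _ _ _) (measurable_tri_apply k i))

lemma obpWt_nonneg (θ : ℝ) {N : ℕ} (a : Fin N → ℝ) (x : Tri (N - 1)) : 0 ≤ obpWt θ a x := by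
  refine Finset.prod_nonneg fun k _ => mul_nonneg
    (Finset.prod_nonneg fun i _ => Finset.prod_nonneg fun j _ => ?_)
    (Finset.prod_nonneg fun s _ => Finset.prod_nonneg fun r _ => by positivity)
  split_ifs <;> positivity

lemma lvl_last {M : ℕ} (a : Fin (M + 2) → ℝ) (x : Tri (M + 1)) (h : M + 1 < M + 2) :
    lvl a x (M + 1) h = a := by
  simp [lvl]

lemma lvl_snoc {M : ℕ} (a : Fin (M + 2) → ℝ) (u : Fin (M + 1) → ℝ) (y : Tri M) (k : Fin M)
    (h : k.1 + 1 < M + 2) :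
    lvl a (Fin.snoc y u : Tri (M + 1)) (k.1 + 1) h =
      lvl (N := M + 1) u y (k.1 + 1) (Nat.succ_lt_succ k.isLt) := by
  have h1 : k.1 + 1 < M + 2 - 1 := Nat.succ_lt_succ k.isLt
  funext i
  by_cases hk : k.1 + 1 < M
  · have h2 : k.1 + 1 < M + 1 - 1 := hk
    simp only [lvl, h1, h2, dif_pos]
    have := Fin.snoc_castSucc (α := fun k : Fin (M + 1) => Fin (k.1 + 1) → ℝ) u y ⟨k.1 + 1, hk⟩
    exact congrFun this i
  · have h2 : ¬ k.1 + 1 < M + 1 - 1 := hk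
    simp only [lvl, h1, h2, dif_pos, dif_neg, not_false_eq_true]
    obtain ⟨k, hkM⟩ := k
    obtain rfl : M = k + 1 := by simp only at hk; omega
    have := Fin.snoc_last (α := fun j : Fin (k + 1 + 1) => Fin (j.1 + 1) → ℝ) u y
    exact congrFun this i

lemma obpWt_snoc (θ : ℝ) {M : ℕ} (a : Fin (M + 2) → ℝ) (u : Fin (M + 1) → ℝ) (y : Tri M) :
    obpWt θ a (Fin.snoc y u : Tri (M + 1)) =
      obpWt (N := M + 1) θ u y *
        (absVandermonde u ^ (2 - 2 * θ) * ∏ s, ∏ r, |a s - u r| ^ (θ - 1)) := by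
  have hy (k : Fin M) := Fin.snoc_castSucc (α := fun k : Fin (M + 1) => Fin (k.1 + 1) → ℝ) u y k
  have hu := Fin.snoc_last (α := fun k : Fin (M + 1) => Fin (k.1 + 1) → ℝ) u y
  have hl (k : Fin M) (h : k.1 + 1 < M + 2) := lvl_snoc a u y k h
  have hl' (h : M + 1 < M + 2) := lvl_last a (Fin.snoc y u : Tri (M + 1)) h
  rw [← prod_rpow_eq_absVandermonde_rpow]
  unfold obpWt
  refine (Fin.prod_univ_castSucc (n := M) _).trans ?_
  congr 1
  · refine Finset.prod_congr rfl fun k _ => ?_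
    congr 1
    · exact Finset.prod_congr rfl fun i _ => Finset.prod_congr rfl fun j _ => by
        rw [show (Fin.snoc y u : Tri (M + 1)) k.castSucc = y k from hy k]
    · exact Finset.prod_congr rfl fun s _ => Finset.prod_congr rfl fun r _ => by
        rw [show (Fin.snoc y u : Tri (M + 1)) k.castSucc = y k from hy k]
        exact congrArg (fun z => |z - y k r| ^ (θ - 1)) (congrFun (hl k _) s)
  · congr 1
    · exact Finset.prod_congr rfl fun i _ => Finset.prod_congr rfl fun j _ => by
        rw [show (Fin.snoc y u : Tri (M + 1)) (Fin.last M) = u from hu]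
    · exact Finset.prod_congr rfl fun s _ => Finset.prod_congr rfl fun r _ => by
        rw [show (Fin.snoc y u : Tri (M + 1)) (Fin.last M) = u from hu]
        exact congrArg (fun z => |z - u r| ^ (θ - 1)) (congrFun (hl' _) s)

lemma snoc_mem_obpDomain {M : ℕ} (a : Fin (M + 2) → ℝ) (u : Fin (M + 1) → ℝ) (y : Tri M) :
    (Fin.snoc y u : Tri (M + 1)) ∈ obpDomain a ↔
      Interlaces u a ∧ y ∈ obpDomain (N := M + 1) u := by
  have hy (k : Fin M) := Fin.snoc_castSucc (α := fun k : Fin (M + 1) => Fin (k.1 + 1) → ℝ) u y k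
  have hu := Fin.snoc_last (α := fun k : Fin (M + 1) => Fin (k.1 + 1) → ℝ) u y
  refine (Fin.forall_fin_succ' (n := M)).trans (and_comm.trans (and_congr ?_ ?_))
  · have h : Interlaces ((Fin.snoc y u : Tri (M + 1)) (Fin.last M))
        (lvl a (Fin.snoc y u : Tri (M + 1)) (M + 1) (Nat.lt_succ_self _)) ↔ Interlaces u a := by
      rw [lvl_last]
      exact iff_of_eq (congrArg (fun z => Interlaces z a) hu)
    exact h
  · refine forall_congr' fun k => ?_
    have h : Interlaces ((Fin.snoc y u : Tri (M + 1)) k.castSucc)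
        (lvl a (Fin.snoc y u : Tri (M + 1)) (k.1 + 1) (by have := k.isLt; omega)) ↔
        Interlaces (y k) (lvl (N := M + 1) u y (k.1 + 1) (Nat.succ_lt_succ k.isLt)) := by
      rw [lvl_snoc]
      exact iff_of_eq (congrArg (fun z => Interlaces z _) (hy k))
    exact h

/-- The constant in the normalization of the orbital beta process. -/
def obpConst (θ : ℝ) (N : ℕ) : ℝ :=
  Real.Gamma θ ^ (N * (N + 1) / 2) / ∏ k : Fin N, Real.Gamma ((k.1 + 1) * θ)

lemma obpConst_nonneg {θ : ℝ} (hθ : 0 < θ) (N : ℕ) : 0 ≤ obpConst θ N :=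
  div_nonneg (pow_nonneg (Real.Gamma_pos_of_pos hθ).le _)
    (Finset.prod_nonneg fun _ _ => (Real.Gamma_pos_of_pos (by positivity)).le)

lemma obpConst_succ (θ : ℝ) (N : ℕ) :
    obpConst θ (N + 1) =
      obpConst θ N * (Real.Gamma θ ^ (N + 1) / Real.Gamma ((N + 1) * θ)) := by
  have h : (N + 1) * (N + 1 + 1) / 2 = N * (N + 1) / 2 + (N + 1) := by
    rw [show (N + 1) * (N + 1 + 1) = N * (N + 1) + (N + 1) * 2 by ring,
      Nat.add_mul_div_right _ _ two_pos]
  rw [obpConst, obpConst, h, pow_add, Fin.prod_univ_castSucc, div_mul_div_comm]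
  simp

lemma lintegral_obpWt {θ : ℝ} (hθ : 0 < θ) (M : ℕ) :
    ∀ a : Fin (M + 1) → ℝ, StrictAnti a →
    ∫⁻ x in obpDomain a, ENNReal.ofReal (obpWt θ a x) =
      ENNReal.ofReal (obpConst θ (M + 1) * absVandermonde a ^ (2 * θ - 1)) := by
  induction M with
  | zero =>
    intro a ha
    have hd : obpDomain a = Set.univ := Set.eq_univ_of_forall fun x k => k.elim0
    have hw (x : Tri (0 + 1 - 1)) : obpWt θ a x = 1 := Finset.prod_eq_one fun k _ => k.elim0
    have hv : (volume : Measure (Tri (0 + 1 - 1))) Set.univ = 1 := by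
      change (volume : Measure (Tri 0)) Set.univ = 1
      rw [Measure.volume_pi_eq_dirac]
      simp
    have hΓ := (Real.Gamma_pos_of_pos hθ).ne'
    simp [hd, hw, hv, obpConst, absVandermonde, hΓ]
  | succ M ih =>
    intro a ha
    have hmp := measurePreserving_snoc fun k : Fin (M + 1) => Fin (k.1 + 1) → ℝ
    have hmeas : Measurable ((obpDomain a).indicator fun x => ENNReal.ofReal (obpWt θ a x)) :=
      (measurable_obpWt θ a).ennreal_ofReal.indicator (measurableSet_obpDomain a)
    rw [← lintegral_indicator (measurableSet_obpDomain a)]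
    refine (hmp.lintegral_comp hmeas).symm.trans ?_
    rw [Measure.volume_eq_prod, lintegral_prod _ (by exact (hmeas.comp hmp.measurable).aemeasurable)]
    have hC := obpConst_nonneg hθ (M + 1)
    calc _ = ∫⁻ u : Fin (M + 1) → ℝ, {u | Interlaces u a}.indicator
          (fun u => ENNReal.ofReal (obpConst θ (M + 1)) *
            ENNReal.ofReal (absVandermonde u * ∏ s, ∏ r, |a s - u r| ^ (θ - 1))) u := by
          refine lintegral_congr fun (u : Fin (M + 1) → ℝ) => ?_
          by_cases hu : Interlaces u a
          · rw [Set.indicator_of_mem (show u ∈ {u | Interlaces u a} from hu)]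
            have hV := absVandermonde_pos hu.strictAnti.injective
            set K := absVandermonde u ^ (2 - 2 * θ) * ∏ s, ∏ r, |a s - u r| ^ (θ - 1) with hK
            have hKV : obpConst θ (M + 1) *
                (absVandermonde u * ∏ s, ∏ r, |a s - u r| ^ (θ - 1)) =
                obpConst θ (M + 1) * absVandermonde u ^ (2 * θ - 1) * K := by
              have hpow : absVandermonde u ^ (2 * θ - 1) * absVandermonde u ^ (2 - 2 * θ) =
                  absVandermonde u := by
                rw [← Real.rpow_add hV, show 2 * θ - 1 + (2 - 2 * θ) = 1 by ring, Real.rpow_one]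
              nth_rw 1 [hK, ← hpow]
              ring
            rw [← ENNReal.ofReal_mul hC, hKV,
              ENNReal.ofReal_mul (mul_nonneg hC (by positivity)), ← ih u hu.strictAnti,
              ← lintegral_mul_const' _ _ ENNReal.ofReal_ne_top,
              ← lintegral_indicator (measurableSet_obpDomain _)]
            refine lintegral_congr fun y => ?_
            by_cases hy : y ∈ obpDomain (N := M + 1) u
            · rw [Set.indicator_of_mem hy]
              refine (Set.indicator_of_mem ((snoc_mem_obpDomain a u y).2 ⟨hu, hy⟩) _).trans ?_
              rw [← ENNReal.ofReal_mul (obpWt_nonneg θ u y)]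
              exact congrArg ENNReal.ofReal (obpWt_snoc θ a u y)
            · rw [Set.indicator_of_notMem hy]
              exact Set.indicator_of_notMem (fun h => hy ((snoc_mem_obpDomain a u y).1 h).2) _
          · rw [Set.indicator_of_notMem (show u ∉ {u | Interlaces u a} from hu)]
            refine lintegral_eq_zero_of_ae_eq_zero (Eventually.of_forall fun y => ?_)
            exact Set.indicator_of_notMem (fun h => hu ((snoc_mem_obpDomain a u y).1 h).1) _
      _ = _ := by
          rw [lintegral_indicator (measurableSet_interlaces a),
            lintegral_const_mul' _ _ ENNReal.ofReal_ne_top, lintegral_interlaces hθ ha,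
            ← ENNReal.ofReal_mul hC, obpConst_succ θ (M + 1), mul_assoc]

/-- Normalization of the orbital beta process (Lemma 2.1):
the interlacing integral of the orbital beta density converges, and equals
`Γ(θ)^{N(N+1)/2} / ∏_{k=1}^N Γ(kθ) · ∏_{i<j} |a_i - a_j|^{2θ-1}`. -/
theorem orbital_beta_normalization
    (θ : ℝ) (hθ : 0 < θ) (N : ℕ) (hN : 1 ≤ N)
    (a : Fin N → ℝ) (ha : StrictAnti a) :
    IntegrableOn (obpWt θ a) (obpDomain a) volume ∧
    ∫ x in obpDomain a, obpWt θ a x =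
      (Real.Gamma θ ^ (N * (N + 1) / 2) /
          ∏ k : Fin N, Real.Gamma ((k.1 + 1) * θ)) *
        ∏ i : Fin N, ∏ j : Fin N,
          if i < j then |a i - a j| ^ (2 * θ - 1) else 1 := by
  obtain ⟨M, rfl⟩ : ∃ M, N = M + 1 := ⟨N - 1, by omega⟩
  have hlin := lintegral_obpWt hθ M a ha
  have hmeas := (measurable_obpWt θ a).aestronglyMeasurable (μ := volume.restrict (obpDomain a))
  have hnn : 0 ≤ᵐ[volume.restrict (obpDomain a)] obpWt θ a :=
    Eventually.of_forall (obpWt_nonneg θ a)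
  refine ⟨⟨hmeas, ?_⟩, ?_⟩
  · rw [hasFiniteIntegral_iff_ofReal hnn, hlin]
    exact ENNReal.ofReal_lt_top
  · rw [integral_eq_lintegral_of_nonneg_ae hnn hmeas, hlin, ENNReal.toReal_ofReal
      (mul_nonneg (obpConst_nonneg hθ _) (Real.rpow_nonneg (absVandermonde_nonneg a) _)),
      prod_rpow_eq_absVandermonde_rpow, obpConst]

end
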